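/- arXiv:2110.05918 — 2 statements merged into one kernel-verified Lean document; each statement's English description precedes it below -/
import Mathlib

section
/- Fix λ ∈ (-1/2, ∞), λ ≠ 0, and let L3(λ,n) = ∫_{-1}^{1} K_n^λ(x,x) · log(1/(1-x²)) · w^λ(x) dx. Then there exist constants C > 0 and N such that for all n ≥ N: | L3(λ,n) - 2n·log 2 + (2λ-1)·log n | ≤ C. -/
open Real MeasureTheory Finset

/-- Gegenbauer polynomials `C_n^λ`, defined by `C_0^λ(x) = 1`, `C_1^λ(x) = 2λx` and the
recurrence `n·C_n^λ(x) = 2(n+λ-1)·x·C_{n-1}^λ(x) - (n+2λ-2)·C_{n-2}^λ(x)`. -/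
noncomputable def Geg (lam : ℝ) : ℕ → ℝ → ℝ
  | 0, _ => 1
  | 1, x => 2 * lam * x
  | (n + 2), x =>
      (2 * ((n : ℝ) + 1 + lam) * x * Geg lam (n + 1) x
        - ((n : ℝ) + 2 * lam) * Geg lam n x) / ((n : ℝ) + 2)

/-- The Gegenbauer weight `w^λ(x) = Γ(λ+1)/(√π·Γ(λ+1/2))·(1-x²)^{λ-1/2}`. -/
noncomputable def wG (lam : ℝ) (x : ℝ) : ℝ :=
  Real.Gamma (lam + 1) / (Real.sqrt Real.pi * Real.Gamma (lam + 1 / 2)) *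
    (1 - x ^ 2) ^ (lam - 1 / 2)

/-- Normalization constant `γ_n^λ = √(n!·(n+λ)/(λ·(2λ)_n))`. -/
noncomputable def gamG (lam : ℝ) (n : ℕ) : ℝ :=
  Real.sqrt ((n.factorial : ℝ) * ((n : ℝ) + lam) /
    (lam * (ascPochhammer ℝ n).eval (2 * lam)))

/-- Normalized Gegenbauer polynomials `Ĉ_n^λ = γ_n^λ·C_n^λ`. -/
noncomputable def GegHat (lam : ℝ) (n : ℕ) (x : ℝ) : ℝ := gamG lam n * Geg lam n x

/-- The Gegenbauer projection kernel `K_n^λ(x,y) = ∑_{j=0}^n Ĉ_j^λ(x)Ĉ_j^λ(y)`. -/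
noncomputable def KG (lam : ℝ) (n : ℕ) (x y : ℝ) : ℝ :=
  ∑ j ∈ Finset.range (n + 1), GegHat lam j x * GegHat lam j y


/-- `L3(λ,n) = ∫ K_n^λ(x,x)·log(1/(1-x²))·w^λ(x) dx`. -/
noncomputable def L3 (lam : ℝ) (n : ℕ) : ℝ :=
  ∫ x in Set.Icc (-1 : ℝ) 1, KG lam n x x * Real.log (1 / (1 - x ^ 2)) * wG lam x


open Filter Topology Polynomial

/-- bound for polynomials on the interval -/
lemma poly_bdd (p : ℝ[X]) : ∃ B : ℝ, 0 ≤ B ∧ ∀ x ∈ Set.Ioo (-1 : ℝ) 1, |p.eval x| ≤ B := by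
  obtain ⟨B, hB⟩ := (isCompact_Icc (a := (-1 : ℝ)) (b := 1)).exists_bound_of_continuousOn
    (p.continuous.continuousOn)
  refine ⟨max B 0, le_max_right _ _, fun x hx => ?_⟩
  exact (hB x (Set.Ioo_subset_Icc_self hx)).trans (le_max_left _ _)

lemma one_sub_sq_pos {x : ℝ} (hx : x ∈ Set.Ioo (-1 : ℝ) 1) : 0 < 1 - x ^ 2 := by
  nlinarith [hx.1, hx.2]

lemma meas_W (s : ℝ) : Measurable (fun x : ℝ => (1 - x ^ 2) ^ s) := by fun_prop

/-- the real beta integral -/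
lemma beta_real (a : ℝ) (ha : 0 < a) :
    IntegrableOn (fun x : ℝ => x ^ (a - 1) * (1 - x) ^ (a - 1)) (Set.Ioc 0 1) ∧
    ∫ x in (0 : ℝ)..1, x ^ (a - 1) * (1 - x) ^ (a - 1) = Gamma a * Gamma a / Gamma (a + a) := by
  have hc := Complex.betaIntegral_convergent (u := a) (v := a) (by simpa) (by simpa)
  rw [intervalIntegrable_iff_integrableOn_Ioc_of_le zero_le_one] at hc
  have heq : ∀ x ∈ Set.Ioc (0 : ℝ) 1, (x : ℂ) ^ ((a : ℂ) - 1) * (1 - (x : ℂ)) ^ ((a : ℂ) - 1)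
      = ((x ^ (a - 1) * (1 - x) ^ (a - 1) : ℝ) : ℂ) := by
    intro x hx
    have h1 : (0 : ℝ) ≤ x := hx.1.le
    have h2 : (0 : ℝ) ≤ 1 - x := by linarith [hx.2]
    push_cast [Complex.ofReal_cpow h1, Complex.ofReal_cpow h2]
    rfl
  have hre : ∀ x ∈ Set.Ioc (0 : ℝ) 1,
      RCLike.re ((x : ℂ) ^ ((a : ℂ) - 1) * (1 - (x : ℂ)) ^ ((a : ℂ) - 1))
      = x ^ (a - 1) * (1 - x) ^ (a - 1) := by
    intro x hx
    rw [heq x hx]; exact Complex.ofReal_re _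
  constructor
  · exact IntegrableOn.congr_fun hc.re (fun x hx => hre x hx) measurableSet_Ioc
  · have := ProbabilityTheory.beta_eq_betaIntegralReal a a ha ha
    rw [ProbabilityTheory.beta] at this
    rw [this, Complex.betaIntegral, intervalIntegral.integral_of_le zero_le_one,
      intervalIntegral.integral_of_le zero_le_one, ← RCLike.re_to_complex, ← integral_re hc]
    exact setIntegral_congr_fun measurableSet_Ioc (fun x hx => (hre x hx).symm)

lemma W_subst (s x : ℝ) (hx : x ∈ Set.Ioo (0 : ℝ) 1) :
    (1 - (2 * x + -1) ^ 2) ^ s = 4 ^ s * (x ^ s * (1 - x) ^ s) := by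
  have h1 : (0 : ℝ) ≤ x := hx.1.le
  have h2 : (0 : ℝ) ≤ 1 - x := by linarith [hx.2]
  rw [← mul_rpow h1 h2, ← mul_rpow (by norm_num) (mul_nonneg h1 h2)]
  congr 1; ring

lemma W_int (s : ℝ) (hs : -1 < s) :
    IntegrableOn (fun x : ℝ => (1 - x ^ 2) ^ s) (Set.Ioo (-1) 1) ∧
    ∫ x in Set.Ioo (-1 : ℝ) 1, (1 - x ^ 2) ^ s
      = 2 * 4 ^ s * (Gamma (s + 1) * Gamma (s + 1) / Gamma (2 * s + 2)) := by
  obtain ⟨h1, h2⟩ := beta_real (s + 1) (by linarith)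
  have hs1 : s + 1 - 1 = s := by ring
  rw [hs1] at h1 h2
  have hI : IntervalIntegrable (fun x : ℝ => (1 - (2 * x + -1) ^ 2) ^ s) volume 0 1 := by
    rw [intervalIntegrable_iff_integrableOn_Ioo_of_le zero_le_one]
    exact IntegrableOn.congr_fun ((h1.mono_set Set.Ioo_subset_Ioc_self).const_mul (4 ^ s))
      (fun x hx => (W_subst s x hx).symm) measurableSet_Ioo
  have hval : ∫ x in (0 : ℝ)..1, (1 - (2 * x + -1) ^ 2) ^ s =
      4 ^ s * (Gamma (s + 1) * Gamma (s + 1) / Gamma (2 * s + 2)) := by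
    rw [show 2 * s + 2 = s + 1 + (s + 1) by ring, ← h2, ← intervalIntegral.integral_const_mul,
      intervalIntegral.integral_of_le zero_le_one, intervalIntegral.integral_of_le zero_le_one,
      integral_Ioc_eq_integral_Ioo, integral_Ioc_eq_integral_Ioo]
    exact setIntegral_congr_fun measurableSet_Ioo (fun x hx => (W_subst s x hx))
  constructor
  · rw [← intervalIntegrable_iff_integrableOn_Ioo_of_le (by norm_num)]
    have h3 := (hI.comp_add_right (1 / 2)).comp_mul_left (c := 1 / 2)
    norm_num at h3
    refine h3.congr ?_
    intro x _
    show (1 - (2 * (1 / 2 * x + 1 / 2) + -1) ^ 2) ^ s = (1 - x ^ 2) ^ s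
    congr 1; ring
  · rw [← integral_Ioc_eq_integral_Ioo, ← intervalIntegral.integral_of_le (by norm_num)]
    have h4 := intervalIntegral.integral_comp_mul_add (a := 0) (b := 1)
      (fun x : ℝ => (1 - x ^ 2) ^ s) (c := 2) two_ne_zero (-1)
    rw [hval] at h4
    norm_num at h4
    linarith

lemma polyW_int (p : ℝ[X]) (s : ℝ) (hs : -1 < s) :
    IntegrableOn (fun x : ℝ => p.eval x * (1 - x ^ 2) ^ s) (Set.Ioo (-1) 1) := by
  obtain ⟨B, _, hB⟩ := poly_bdd p
  refine Integrable.bdd_mul (c := B) (W_int s hs).1 (p.continuous.aestronglyMeasurable) ?_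
  exact (ae_restrict_iff' measurableSet_Ioo).2 (Eventually.of_forall hB)

/-- Gegenbauer functional -/
noncomputable def LL (s : ℝ) (p : ℝ[X]) : ℝ :=
  ∫ x in Set.Ioo (-1 : ℝ) 1, p.eval x * (1 - x ^ 2) ^ (s - 1 / 2)

lemma LL_add (s : ℝ) (hs : -(1 / 2) < s) (p q : ℝ[X]) : LL s (p + q) = LL s p + LL s q := by
  unfold LL
  rw [← integral_add (polyW_int p _ (by linarith)) (polyW_int q _ (by linarith))]
  simp [add_mul]

lemma LL_C_mul (s c : ℝ) (p : ℝ[X]) : LL s (C c * p) = c * LL s p := by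
  unfold LL
  rw [← integral_const_mul]
  simp [mul_assoc]

lemma LL_zero (s : ℝ) : LL s 0 = 0 := by simp [LL]

lemma LL_sq_nonneg (s : ℝ) (p : ℝ[X]) : 0 ≤ LL s (p * p) := by
  unfold LL
  refine setIntegral_nonneg measurableSet_Ioo fun x hx => ?_
  have := rpow_nonneg (one_sub_sq_pos hx).le (s - 1 / 2)
  rw [eval_mul]
  exact mul_nonneg (mul_self_nonneg _) this

lemma LL_one (s : ℝ) (hs : -(1 / 2) < s) :
    LL s 1 = 2 * 4 ^ (s - 1 / 2) * (Gamma (s + 1 / 2) * Gamma (s + 1 / 2) / Gamma (2 * s + 1)) := by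
  have := (W_int (s - 1 / 2) (by linarith)).2
  unfold LL
  simp only [eval_one, one_mul]
  rw [this]
  ring_nf

lemma LL_split (s : ℝ) (hs : -(1 / 2) < s) (p : ℝ[X]) :
    LL s p = LL (s + 1) p + LL s (X * (X * p)) := by
  unfold LL
  rw [← integral_add (polyW_int p _ (by linarith)) (polyW_int _ _ (by linarith))]
  refine setIntegral_congr_fun measurableSet_Ioo fun x hx => ?_
  simp only [eval_mul, eval_X]
  rw [show s + 1 - 1 / 2 = (s - 1 / 2) + 1 by ring, rpow_add_one (one_sub_sq_pos hx).ne']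
  ring

lemma LL_parts (s : ℝ) (hs : -(1 / 2) < s) (p : ℝ[X]) :
    (2 * s + 1) * LL s (X * p) = LL (s + 1) (derivative p) := by
  have hF := intervalIntegral.integral_eq_sub_of_hasDerivAt_of_le (a := -1) (b := 1)
    (f := fun x : ℝ => p.eval x * (1 - x ^ 2) ^ (s + 1 / 2))
    (f' := fun x : ℝ => (derivative p).eval x * (1 - x ^ 2) ^ (s + 1 - 1 / 2) -
      (2 * s + 1) * ((X * p).eval x * (1 - x ^ 2) ^ (s - 1 / 2))) (by norm_num) ?_ ?_ ?_
  · rw [intervalIntegral.integral_of_le (by norm_num), integral_Ioc_eq_integral_Ioo,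
      integral_sub (polyW_int _ _ (by linarith)) ((polyW_int _ _ (by linarith)).const_mul _),
      integral_const_mul] at hF
    have h0 : (0 : ℝ) ^ (s + 1 / 2) = 0 := zero_rpow (by linarith)
    norm_num [h0] at hF
    unfold LL
    simp only [eval_mul, eval_X, one_div] at *
    norm_num at *
    linarith
  · apply ContinuousOn.mul p.continuous.continuousOn
    apply ContinuousOn.rpow_const (by fun_prop)
    intro x _; right; linarith
  · intro x hx
    have hp := one_sub_sq_pos hx
    have h1 : HasDerivAt (fun x : ℝ => 1 - x ^ 2) (-(2 * x)) x := by
      simpa using ((hasDerivAt_pow 2 x).const_sub 1)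
    have h2 := (p.hasDerivAt x).mul (h1.rpow_const (p := s + 1 / 2) (Or.inl hp.ne'))
    refine HasDerivAt.congr_deriv (f' := _) h2 ?_
    rw [show s + 1 - 1 / 2 = s + 1 / 2 by ring, show s + 1 / 2 - 1 = s - 1 / 2 by ring]
    simp only [eval_mul, eval_X]
    ring
  · rw [intervalIntegrable_iff_integrableOn_Ioo_of_le (by norm_num)]
    exact (polyW_int _ _ (by linarith)).sub ((polyW_int _ _ (by linarith)).const_mul _)

lemma LL_three (s : ℝ) (hs : -(1 / 2) < s) (r : ℝ[X]) :
    (2 * s + 1) * LL s r = (2 * s + 2) * LL (s + 1) r + LL (s + 1) (X * derivative r) := by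
  have h1 := LL_split s hs r
  have h2 := LL_parts s hs (X * r)
  rw [derivative_mul, derivative_X, one_mul, LL_add _ (by linarith)] at h2
  rw [h1]
  linarith

noncomputable def bG (s : ℝ) (n : ℕ) : ℝ :=
  ((n : ℝ) + 1) * (n + 2 * s) / (4 * (n + 1 + s) * (n + s))

/-- monic Gegenbauer polynomials -/
noncomputable def PP (s : ℝ) : ℕ → ℝ[X]
  | 0 => 1
  | 1 => X
  | (n + 2) => X * PP s (n + 1) - C (bG s n) * PP s n

noncomputable def cG (s : ℝ) : ℕ → ℝ
  | 0 => 1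
  | (n + 1) => cG s n * ((2 * s + n) / ((2 * s + 2 * n + 1) * (2 * s + 2 * n)))

noncomputable def kG (s : ℝ) : ℕ → ℝ
  | 0 => 1
  | (n + 1) => kG s n * (2 * (s + n) / (n + 1))

lemma s_add_ne {s : ℝ} (hs : -(1 / 2) < s) (h0 : s ≠ 0) (n : ℕ) : s + n ≠ 0 := by
  rcases n with _ | n
  · simpa using h0
  · push_cast
    have : (0 : ℝ) ≤ n := n.cast_nonneg
    intro h; linarith

lemma LL_sub (s : ℝ) (hs : -(1 / 2) < s) (p q : ℝ[X]) : LL s (p - q) = LL s p - LL s q := by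
  have h := LL_add s hs (p - q) q
  rw [sub_add_cancel] at h
  linarith

lemma LL_PP (s : ℝ) (hs : -(1 / 2) < s) (h0 : s ≠ 0) (n : ℕ) : ∀ q : ℝ[X],
    LL s (PP s n * q) = cG s n * LL (s + n) (derivative^[n] q) := by
  induction n using Nat.twoStepInduction with
  | zero => intro q; simp [PP, cG]
  | one =>
    intro q
    have := LL_parts s hs q
    simp only [PP, cG, Function.iterate_one, Nat.cast_one, Nat.cast_zero]
    rw [← this]
    have h1 : 2 * s + 1 ≠ 0 := by intro h; linarith
    norm_num
    field_simp
  | more n ih0 ih1 =>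
    intro q
    have hn : (0 : ℝ) ≤ n := n.cast_nonneg
    have hsn := s_add_ne hs h0 n
    have e1 : PP s (n + 2) * q = PP s (n + 1) * (X * q) - C (bG s n) * (PP s n * q) := by
      simp only [PP]; ring
    have e2 : derivative^[n + 1] (X * q) =
        X * derivative (derivative^[n] q) + C ((n : ℝ) + 1) * derivative^[n] q := by
      rw [mul_comm X q, iterate_derivative_mul_X, Function.iterate_succ_apply']
      simp [nsmul_eq_mul, mul_comm]
    have h3 := LL_three (s + n) (by linarith) (derivative^[n] q)
    have h4 := LL_parts (s + n + 1) (by linarith) (derivative (derivative^[n] q))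
    rw [e1, LL_sub s hs, LL_C_mul, ih0, ih1, e2, LL_add _ (by push_cast; linarith), LL_C_mul,
      Function.iterate_succ_apply', Function.iterate_succ_apply']
    push_cast
    rw [show s + ((n : ℝ) + 1) = s + n + 1 by ring, show s + ((n : ℝ) + 2) = s + n + 1 + 1 by ring,
      ← h4]
    set A := LL (s + n) (derivative^[n] q)
    set B := LL (s + n + 1) (derivative^[n] q)
    set D := LL (s + n + 1) (X * derivative (derivative^[n] q))
    have hp1 : 2 * (s + n) + 1 ≠ 0 := by intro h; linarith
    have hp2 : s + n + 1 ≠ 0 := by intro h; linarith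
    have hp3 : 2 * (s + n + 1) + 1 ≠ 0 := by intro h; linarith
    have hA : A = ((2 * (s + n) + 2) * B + D) / (2 * (s + n) + 1) := by
      field_simp; linarith
    rw [hA]
    simp only [cG, bG]
    push_cast
    rw [show (n : ℝ) + 1 + s = s + n + 1 by ring, show (n : ℝ) + s = s + n by ring,
      show 2 * s + 2 * (n : ℝ) + 1 = 2 * (s + n) + 1 by ring,
      show 2 * s + 2 * (n : ℝ) = 2 * (s + n) by ring,
      show 2 * s + 2 * ((n : ℝ) + 1) + 1 = 2 * (s + n + 1) + 1 by ring,
      show 2 * s + 2 * ((n : ℝ) + 1) = 2 * (s + n + 1) by ring]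
    field_simp
    ring

lemma PP_monic (s : ℝ) (n : ℕ) : (PP s n).Monic ∧ (PP s n).natDegree = n := by
  induction n using Nat.twoStepInduction with
  | zero => simp [PP]
  | one => simp [PP]
  | more n ih0 ih1 =>
    have hX : (X * PP s (n + 1)).Monic := monic_X.mul ih1.1
    have hd : (X * PP s (n + 1)).natDegree = n + 2 := by
      rw [monic_X.natDegree_mul ih1.1, ih1.2, natDegree_X]; ring
    have hlt : (C (bG s n) * PP s n).degree < (X * PP s (n + 1)).degree := by
      refine lt_of_le_of_lt ((degree_mul_le _ _).trans (add_le_add_left degree_C_le _)) ?_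
      rw [zero_add]
      rw [degree_eq_natDegree hX.ne_zero, degree_eq_natDegree ih0.1.ne_zero, hd, ih0.2]
      exact_mod_cast (by omega : n < n + 2)
    simp only [PP]
    constructor
    · exact hX.sub_of_left hlt
    · rw [natDegree_sub_eq_left_of_natDegree_lt, hd]
      exact (natDegree_C_mul_le _ _).trans_lt (by rw [hd, ih0.2]; omega)

noncomputable def eG (s : ℝ) (n : ℕ) : ℝ := cG s n * (n.factorial * LL (s + n) 1)

lemma deriv_diff_zero {n : ℕ} {p q : ℝ[X]} (hp : p.Monic) (hq : q.Monic)
    (hpn : p.natDegree = n) (hqn : q.natDegree = n) : derivative^[n] (p - q) = 0 := by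
  have h : (p - q).degree < p.degree := degree_sub_lt_left
    (by rw [degree_eq_natDegree hp.ne_zero, degree_eq_natDegree hq.ne_zero, hpn, hqn])
    hp.ne_zero (by rw [hp.leadingCoeff, hq.leadingCoeff])
  rw [degree_eq_natDegree hp.ne_zero, hpn] at h
  exact iterate_derivative_eq_zero_of_degree_lt h

lemma LL_PP_monic (s : ℝ) (hs : -(1 / 2) < s) (h0 : s ≠ 0) (n : ℕ) (p : ℝ[X])
    (hp : p.Monic) (hpn : p.natDegree = n) : LL s (PP s n * p) = eG s n := by
  have h1 := LL_PP s hs h0 n (p - X ^ n)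
  have h2 := LL_PP s hs h0 n (X ^ n)
  rw [deriv_diff_zero hp (monic_X_pow n) hpn (natDegree_X_pow n), LL_zero, mul_sub, LL_sub s hs] at h1
  rw [iterate_derivative_X_pow_eq_C_mul, Nat.sub_self, pow_zero, Nat.descFactorial_self,
    LL_C_mul] at h2
  unfold eG
  linarith

lemma LL_min (s : ℝ) (hs : -(1 / 2) < s) (h0 : s ≠ 0) (n : ℕ) (p : ℝ[X])
    (hp : p.Monic) (hpn : p.natDegree = n) : eG s n ≤ LL s (p * p) := by
  have h1 := LL_PP_monic s hs h0 n p hp hpn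
  have h2 := LL_PP_monic s hs h0 n _ (PP_monic s n).1 (PP_monic s n).2
  have h3 := LL_sq_nonneg s (p - PP s n)
  have e : (p - PP s n) * (p - PP s n) = p * p - PP s n * p - PP s n * p + PP s n * PP s n := by ring
  rw [e, LL_add s hs, LL_sub s hs, LL_sub s hs] at h3
  linarith

lemma Geg_eq (s : ℝ) (hs : -(1 / 2) < s) (h0 : s ≠ 0) (n : ℕ) (x : ℝ) :
    Geg s n x = kG s n * (PP s n).eval x := by
  induction n using Nat.twoStepInduction with
  | zero => simp [PP, kG, Geg]
  | one => simp [PP, kG, Geg]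
  | more n ih0 ih1 =>
    have hn : (0 : ℝ) ≤ n := n.cast_nonneg
    have hsn := s_add_ne hs h0 n
    have hsn1 := s_add_ne hs h0 (n + 1)
    push_cast at hsn1
    simp only [Geg, PP, kG] at *
    rw [ih0, ih1]
    simp only [eval_sub, eval_mul, eval_X, eval_C, bG]
    push_cast
    rw [show (n : ℝ) + 1 + s = s + (n + 1) by ring, show (n : ℝ) + s = s + n by ring]
    have : (n : ℝ) + 1 ≠ 0 := by positivity
    have : (n : ℝ) + 2 ≠ 0 := by positivity
    have : (n : ℝ) + 1 + 1 ≠ 0 := by positivity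
    field_simp
    ring

lemma norm_id (s : ℝ) (hs : -(1 / 2) < s) (h0 : s ≠ 0) (n : ℕ) :
    kG s n ^ 2 * eG s n * (n.factorial * (n + s)) =
      LL s 1 * (s * (ascPochhammer ℝ n).eval (2 * s)) := by
  induction n with
  | zero => simp [kG, eG, cG]
  | succ n ih =>
    have hn : (0 : ℝ) ≤ n := n.cast_nonneg
    have hsn := s_add_ne hs h0 n
    have h3 := LL_three (s + n) (by linarith) 1
    simp only [derivative_one, mul_zero, LL_zero, add_zero] at h3
    have hp1 : 2 * (s + n) + 1 ≠ 0 := by intro h; linarith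
    have hp2 : s + n + 1 ≠ 0 := by intro h; linarith
    have hn1 : (n : ℝ) + 1 ≠ 0 := by positivity
    have hL : LL (s + n + 1) 1 = (2 * (s + n) + 1) * LL (s + n) 1 / (2 * (s + n + 1)) := by
      field_simp; linarith
    rw [ascPochhammer_succ_eval, ← mul_assoc s, ← mul_assoc (LL s 1), ← ih]
    unfold eG
    simp only [kG, cG, Nat.factorial_succ]
    push_cast
    rw [show s + ((n : ℝ) + 1) = s + n + 1 by ring, hL,
      show 2 * s + 2 * (n : ℝ) + 1 = 2 * (s + n) + 1 by ring,
      show 2 * s + 2 * (n : ℝ) = 2 * (s + n) by ring]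
    field_simp
    ring

lemma cG_Gamma (s : ℝ) (hs : -(1 / 2) < s) (h0 : s ≠ 0) (n : ℕ) :
    cG s (n + 1) * Gamma (2 * (s + n + 1)) = Gamma (2 * s + n + 1) := by
  induction n with
  | zero =>
    simp only [cG]
    have h1 : 2 * s + 1 ≠ 0 := by intro h; linarith
    rw [show 2 * (s + ((0 : ℕ) : ℝ) + 1) = 2 * s + 1 + 1 by push_cast; ring, Gamma_add_one h1]
    norm_num
    field_simp
  | succ n ih =>
    have hn : (0 : ℝ) ≤ n := n.cast_nonneg
    rw [cG]
    push_cast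
    have h1 : 2 * (s + n + 1) ≠ 0 := by intro h; linarith
    have h2 : 2 * (s + n + 1) + 1 ≠ 0 := by intro h; linarith
    have h3 : 2 * s + n + 1 ≠ 0 := by intro h; linarith
    rw [show 2 * (s + ((n : ℝ) + 1) + 1) = 2 * (s + n + 1) + 1 + 1 by ring, Gamma_add_one h2,
      Gamma_add_one h1, show 2 * s + ((n : ℝ) + 1) + 1 = 2 * s + n + 1 + 1 by ring,
      Gamma_add_one h3, ← ih,
      show 2 * s + 2 * ((n : ℝ) + 1) = 2 * (s + n + 1) by ring]
    have h1' : s + n + 1 ≠ 0 := by intro h; linarith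
    field_simp
    ring

lemma eG_Gamma (s : ℝ) (hs : -(1 / 2) < s) (h0 : s ≠ 0) (n : ℕ) :
    eG s (n + 1) = (n + 1).factorial * π * 4 ^ (1 - (s + n + 1)) * Gamma (2 * s + n + 1) /
      (2 * (s + n + 1) * Gamma (s + n + 1) ^ 2) := by
  have hn : (0 : ℝ) ≤ n := n.cast_nonneg
  have h1 := cG_Gamma s hs h0 n
  have h2 := LL_one (s + n + 1) (by linarith)
  have h3 := Gamma_mul_Gamma_add_half (s + n + 1)
  have hG : Gamma (2 * (s + n + 1)) ≠ 0 := (Gamma_pos_of_pos (by linarith)).ne'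
  have hG1 : Gamma (s + n + 1) ≠ 0 := (Gamma_pos_of_pos (by linarith)).ne'
  have hz : 2 * (s + n + 1) ≠ 0 := by intro h; linarith
  have h5 : Gamma (s + n + 1 + 1 / 2) = Gamma (2 * (s + n + 1)) * 2 ^ (1 - 2 * (s + n + 1)) * √π
      / Gamma (s + n + 1) := by
    rw [eq_div_iff hG1, ← h3]; ring
  unfold eG
  push_cast
  rw [show s + ((n : ℝ) + 1) = s + n + 1 by ring, h2, h5, Gamma_add_one hz, ← h1]
  set z := s + n + 1
  have hpow : (4 : ℝ) ^ (1 - z) = 2 * 4 ^ (z - 1 / 2) * (2 ^ (1 - 2 * z)) ^ 2 := by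
    rw [show (4 : ℝ) = 2 ^ (2 : ℝ) by norm_num, ← rpow_mul (by norm_num), ← rpow_mul (by norm_num),
      ← rpow_natCast, ← rpow_mul (by norm_num)]
    rw [show 2 * (1 - z) = 1 + 2 * (z - 1 / 2) + (1 - 2 * z) * ((2 : ℕ) : ℝ) by push_cast; ring,
      rpow_add (by norm_num), rpow_add (by norm_num), rpow_one]
  rw [hpow]
  have hpi : √π ^ 2 = π := sq_sqrt pi_pos.le
  have hz' : z ≠ 0 := by intro h; simp [h] at hz
  field_simp
  rw [hpi]

lemma LL_hasDerivAt (s : ℝ) (hs : -(1 / 2) < s) (p : ℝ[X]) :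
    IntegrableOn (fun x : ℝ => p.eval x * ((1 - x ^ 2) ^ (s - 1 / 2) * Real.log (1 - x ^ 2)))
      (Set.Ioo (-1) 1) ∧
    HasDerivAt (fun t => LL t p)
      (∫ x in Set.Ioo (-1 : ℝ) 1, p.eval x * ((1 - x ^ 2) ^ (s - 1 / 2) * Real.log (1 - x ^ 2))) s := by
  obtain ⟨B, hB0, hB⟩ := poly_bdd p
  set d : ℝ := (s + 1 / 2) / 4 with hd
  have hdpos : 0 < d := by rw [hd]; linarith
  have hsd : s = 4 * d - 1 / 2 := by rw [hd]; ring
  unfold LL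
  refine hasDerivAt_integral_of_dominated_loc_of_deriv_le
    (F := fun t x => p.eval x * (1 - x ^ 2) ^ (t - 1 / 2))
    (F' := fun t x => p.eval x * ((1 - x ^ 2) ^ (t - 1 / 2) * Real.log (1 - x ^ 2)))
    (s := Set.Ioi (s - 2 * d)) (bound := fun x => B * (1 / d) * (1 - x ^ 2) ^ (d - 1))
    (Ioi_mem_nhds (by linarith)) ?_ ?_ ?_ ?_ ?_ ?_
  · refine Eventually.of_forall fun t => ?_
    exact (p.continuous.measurable.mul (meas_W _)).aestronglyMeasurable
  · exact polyW_int p _ (by linarith)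
  · have : Measurable (fun x : ℝ => Real.log (1 - x ^ 2)) := by fun_prop
    exact (p.continuous.measurable.mul ((meas_W _).mul this)).aestronglyMeasurable
  · refine (ae_restrict_iff' measurableSet_Ioo).2 (Eventually.of_forall fun x hx t ht => ?_)
    have hu := one_sub_sq_pos hx
    have hu1 : 1 - x ^ 2 ≤ 1 := by nlinarith [sq_nonneg x]
    have ht' : s - 2 * d < t := ht
    have h1 : (1 - x ^ 2) ^ (t - 1 / 2) ≤ (1 - x ^ 2) ^ (d + (d - 1)) :=
      rpow_le_rpow_of_exponent_ge hu hu1 (by linarith)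
    have h2 := (abs_log_mul_self_rpow_lt (1 - x ^ 2) d hu hu1 hdpos).le
    have h3 := rpow_nonneg hu.le (d - 1)
    have h4 := rpow_nonneg hu.le d
    rw [rpow_add hu] at h1
    rw [norm_eq_abs, abs_mul, abs_mul, abs_of_nonneg (rpow_nonneg hu.le _), mul_assoc]
    refine mul_le_mul (hB x hx) ?_ (by positivity) hB0
    rw [abs_mul, abs_of_nonneg h4] at h2
    calc _ ≤ (1 - x ^ 2) ^ d * (1 - x ^ 2) ^ (d - 1) * |Real.log (1 - x ^ 2)| :=
          mul_le_mul_of_nonneg_right h1 (abs_nonneg _)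
      _ = (|Real.log (1 - x ^ 2)| * (1 - x ^ 2) ^ d) * (1 - x ^ 2) ^ (d - 1) := by ring
      _ ≤ _ := mul_le_mul_of_nonneg_right h2 h3
  · exact (W_int (d - 1) (by linarith)).1.const_mul _
  · refine (ae_restrict_iff' measurableSet_Ioo).2 (Eventually.of_forall fun x hx t ht => ?_)
    have hu := one_sub_sq_pos hx
    have h1 : HasDerivAt (fun t : ℝ => t - 1 / 2) 1 t := (hasDerivAt_id t).sub_const _
    have := (h1.const_rpow hu).const_mul (p.eval x)
    refine this.congr_deriv ?_
    ring

noncomputable def psi (x : ℝ) : ℝ := deriv Gamma x / Gamma x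

lemma Gamma_hasDerivAt (x : ℝ) (hx : 0 < x) : HasDerivAt Gamma (Gamma x * psi x) x := by
  have h : DifferentiableAt ℝ Gamma x := differentiableAt_Gamma (fun m hm => by
    have : (0 : ℝ) ≤ m := m.cast_nonneg
    linarith)
  have := (Gamma_pos_of_pos hx).ne'
  refine h.hasDerivAt.congr_deriv ?_
  unfold psi; field_simp

lemma psi_add_one (x : ℝ) (hx : 0 < x) : psi (x + 1) = psi x + 1 / x := by
  have hG := (Gamma_pos_of_pos hx).ne'
  have h1 := (Gamma_hasDerivAt (x + 1) (by linarith)).comp x ((hasDerivAt_id x).add_const 1)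
  have h2 := (hasDerivAt_id x).mul (Gamma_hasDerivAt x hx)
  have h3 : (Gamma ∘ fun y => id y + 1) =ᶠ[𝓝 x] id * Gamma := by
    filter_upwards [lt_mem_nhds hx] with y hy
    simp [Gamma_add_one hy.ne']
  have h4 := (h1.congr_of_eventuallyEq h3.symm).unique h2
  simp only [id, mul_one, one_mul] at h4
  rw [Gamma_add_one hx.ne'] at h4
  field_simp
  have : Gamma x * (x * psi (x + 1)) = Gamma x * (x * psi x + 1) := by linarith
  exact mul_left_cancel₀ hG this

lemma logGamma_hasDerivAt (x : ℝ) (hx : 0 < x) : HasDerivAt (Real.log ∘ Gamma) (psi x) x := by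
  have hG := (Gamma_pos_of_pos hx).ne'
  have := (Gamma_hasDerivAt x hx).log hG
  refine this.congr_deriv ?_
  field_simp

lemma psi_bounds (x : ℝ) (hx : 0 < x) : psi x ≤ Real.log x ∧ Real.log x ≤ psi x + 1 / x := by
  have hG := (Gamma_pos_of_pos hx).ne'
  have hx1 : 0 < x + 1 := by linarith
  have hsl : slope (Real.log ∘ Gamma) x (x + 1) = Real.log x := by
    rw [slope_def_field]
    simp [Gamma_add_one hx.ne', Real.log_mul hx.ne' hG]
  constructor
  · rw [← hsl]
    exact convexOn_log_Gamma.le_slope_of_hasDerivAt hx hx1 (by linarith) (logGamma_hasDerivAt x hx)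
  · rw [← hsl, ← psi_add_one x hx]
    exact convexOn_log_Gamma.slope_le_of_hasDerivAt hx hx1 (by linarith)
      (logGamma_hasDerivAt (x + 1) hx1)

lemma eG_hasDerivAt (s : ℝ) (hs : -(1 / 2) < s) (h0 : s ≠ 0) (n : ℕ) :
    0 < eG s (n + 1) ∧
    HasDerivAt (fun t => eG t (n + 1)) (eG s (n + 1) *
      (-(2 * Real.log 2) + 2 * psi (2 * s + n + 1) - 1 / (s + n + 1) - 2 * psi (s + n + 1))) s := by
  have hn : (0 : ℝ) ≤ n := n.cast_nonneg
  have hz : 0 < s + n + 1 := by linarith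
  have hz2 : 0 < 2 * s + n + 1 := by linarith
  have hG := Gamma_pos_of_pos hz
  have hG2 := Gamma_pos_of_pos hz2
  have hev : (fun t => eG t (n + 1)) =ᶠ[𝓝 s] fun t =>
      (n + 1).factorial * π * 4 ^ (1 - (t + n + 1)) * Gamma (2 * t + n + 1) /
      (2 * (t + n + 1) * Gamma (t + n + 1) ^ 2) := by
    filter_upwards [lt_mem_nhds hs, eventually_ne_nhds h0] with t ht ht0
    exact eG_Gamma t ht ht0 n
  have hpos : (0 : ℝ) < (n + 1).factorial * π * 4 ^ (1 - (s + n + 1)) := by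
    have := pi_pos
    positivity
  constructor
  · rw [eG_Gamma s hs h0 n]
    positivity
  · refine HasDerivAt.congr_of_eventuallyEq ?_ hev
    rw [eG_Gamma s hs h0 n]
    have d1 : HasDerivAt (fun t : ℝ => t + n + 1) 1 s :=
      ((hasDerivAt_id s).add_const (n : ℝ)).add_const 1
    have d2 : HasDerivAt (fun t : ℝ => 2 * t + n + 1) 2 s := by
      simpa using (((hasDerivAt_id s).const_mul 2).add_const (n : ℝ)).add_const 1
    have d3 := ((d1.const_sub 1).const_rpow (a := 4) (by norm_num)).const_mul ((n + 1).factorial * π)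
    have d4 := (Gamma_hasDerivAt _ hz2).comp s d2
    have d5 := ((Gamma_hasDerivAt _ hz).comp s d1).pow 2
    have d6 := (d3.mul d4).div ((d1.const_mul 2).mul d5) (by
      simp only [Pi.mul_apply, Pi.pow_apply, Function.comp]; positivity)
    refine d6.congr_deriv ?_
    have hl4 : Real.log 4 = 2 * Real.log 2 := by
      rw [show (4 : ℝ) = 2 ^ 2 by norm_num, Real.log_pow]; push_cast; ring
    simp only [Pi.mul_apply, Pi.pow_apply, Function.comp, hl4]
    have := pi_pos
    field_simp
    ring

lemma main_deriv (s : ℝ) (hs : -(1 / 2) < s) (h0 : s ≠ 0) (n : ℕ) :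
    ∫ x in Set.Ioo (-1 : ℝ) 1, (PP s (n + 1) * PP s (n + 1)).eval x *
      ((1 - x ^ 2) ^ (s - 1 / 2) * Real.log (1 - x ^ 2)) = eG s (n + 1) *
      (-(2 * Real.log 2) + 2 * psi (2 * s + n + 1) - 1 / (s + n + 1) - 2 * psi (s + n + 1)) := by
  have h1 := (LL_hasDerivAt s hs (PP s (n + 1) * PP s (n + 1))).2
  have h2 := (eG_hasDerivAt s hs h0 n).2
  have h3 := h1.sub h2
  have hmon := PP_monic s (n + 1)
  have hmin : IsLocalMin ((fun t => LL t (PP s (n + 1) * PP s (n + 1))) - fun t => eG t (n + 1)) s := by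
    filter_upwards [lt_mem_nhds hs, eventually_ne_nhds h0] with t ht ht0
    simp only [Pi.sub_apply]
    rw [LL_PP_monic s hs h0 (n + 1) _ hmon.1 hmon.2, sub_self]
    linarith [LL_min t ht ht0 (n + 1) _ hmon.1 hmon.2]
  have h4 := hmin.hasDerivAt_eq_zero h3
  linarith

lemma sum_psi (a : ℝ) (ha : -1 < a) (n : ℕ) :
    ∑ j ∈ Finset.range n, psi (a + j + 1) = (a + n) * psi (a + n + 1) - n - a * psi (a + 1) := by
  induction n with
  | zero => simp
  | succ n ih =>
    have hn : (0 : ℝ) ≤ n := n.cast_nonneg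
    have hx : 0 < a + n + 1 := by linarith
    have h := psi_add_one (a + n + 1) hx
    rw [Finset.sum_range_succ, ih]
    push_cast
    rw [show a + ((n : ℝ) + 1) + 1 = a + n + 1 + 1 by ring, h]
    field_simp
    ring

lemma sum_inv (a : ℝ) (ha : -1 < a) (n : ℕ) :
    ∑ j ∈ Finset.range n, 1 / (a + j + 1) = psi (a + n + 1) - psi (a + 1) := by
  induction n with
  | zero => simp
  | succ n ih =>
    have hn : (0 : ℝ) ≤ n := n.cast_nonneg
    have h := psi_add_one (a + n + 1) (by linarith)
    rw [Finset.sum_range_succ, ih]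
    push_cast
    rw [show a + ((n : ℝ) + 1) + 1 = a + n + 1 + 1 by ring, h]
    ring

lemma psi_asym (a c : ℝ) (ha : -1 < a) (n : ℕ) (hn : 1 ≤ n) :
    |(c + n) * (psi (a + n + 1) - Real.log n)| ≤ (|c| + 1) * (a + 2) := by
  have hn1 : (1 : ℝ) ≤ n := by exact_mod_cast hn
  have hn0 : (0 : ℝ) < n := by linarith
  have hx : 0 < a + n + 1 := by linarith
  obtain ⟨h1, h2⟩ := psi_bounds (a + n + 1) hx
  have h3 : Real.log n ≤ Real.log (a + n + 1) := Real.log_le_log hn0 (by linarith)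
  have h4 : Real.log (a + n + 1) - Real.log n ≤ (a + 1) / n := by
    rw [← Real.log_div hx.ne' hn0.ne']
    refine (Real.log_le_sub_one_of_pos (by positivity)).trans (le_of_eq ?_)
    field_simp; ring
  have h5 : 1 / (a + n + 1) ≤ 1 / n := one_div_le_one_div_of_le hn0 (by linarith)
  have h6 : 0 ≤ (a + 1) / n := div_nonneg (by linarith) hn0.le
  have h7 : (0 : ℝ) < 1 / n := by positivity
  have h8 : |psi (a + n + 1) - Real.log n| ≤ (a + 2) / n := by
    have : (a + 2) / n = (a + 1) / n + 1 / (n : ℝ) := by ring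
    rw [this, abs_le]
    constructor <;> linarith
  have h9 : |c + n| ≤ (|c| + 1) * n := by
    refine (abs_add_le _ _).trans ?_
    rw [abs_of_pos hn0]
    nlinarith [abs_nonneg c]
  rw [abs_mul]
  calc _ ≤ (|c| + 1) * n * ((a + 2) / n) :=
        mul_le_mul h9 h8 (abs_nonneg _) (by positivity)
    _ = _ := by field_simp

noncomputable def cst (s : ℝ) : ℝ := Gamma (s + 1) / (√π * Gamma (s + 1 / 2))

lemma cst_mul (s : ℝ) (hs : -(1 / 2) < s) : cst s * LL s 1 = 1 := by
  have hG : 0 < Gamma (s + 1 / 2) := Gamma_pos_of_pos (by linarith)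
  have hG2 : 0 < Gamma (2 * s + 1) := Gamma_pos_of_pos (by linarith)
  have h := Gamma_mul_Gamma_add_half (s + 1 / 2)
  rw [show s + 1 / 2 + 1 / 2 = s + 1 by ring, show 2 * (s + 1 / 2) = 2 * s + 1 by ring,
    show 1 - (2 * s + 1) = -(2 * s) by ring] at h
  have hG1 : Gamma (s + 1) = Gamma (2 * s + 1) * 2 ^ (-(2 * s)) * √π / Gamma (s + 1 / 2) := by
    rw [eq_div_iff hG.ne', ← h]; ring
  have hpow : 2 * (4 : ℝ) ^ (s - 1 / 2) * 2 ^ (-(2 * s)) = 1 := by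
    rw [show (4 : ℝ) = 2 ^ (2 : ℝ) by norm_num, ← rpow_mul (by norm_num)]
    have : (2 : ℝ) ^ (1 + 2 * (s - 1 / 2) + -(2 * s)) = 1 := by
      rw [show 1 + 2 * (s - 1 / 2) + -(2 * s) = 0 by ring, rpow_zero]
    rwa [rpow_add (by norm_num), rpow_add (by norm_num), rpow_one] at this
  have hpi : 0 < √π := sqrt_pos.2 pi_pos
  rw [cst, LL_one s hs, hG1]
  generalize Gamma (s + 1 / 2) = g at *
  generalize Gamma (2 * s + 1) = k at *
  generalize (4 : ℝ) ^ (s - 1 / 2) = u at *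
  generalize (2 : ℝ) ^ (-(2 * s)) = v at *
  field_simp
  linarith

lemma gam_norm (s : ℝ) (hs : -(1 / 2) < s) (h0 : s ≠ 0) (n : ℕ) :
    gamG s (n + 1) ^ 2 * kG s (n + 1) ^ 2 * cst s * eG s (n + 1) = 1 := by
  have hid := norm_id s hs h0 (n + 1)
  have he := (eG_hasDerivAt s hs h0 n).1
  have hn : (0 : ℝ) ≤ n := n.cast_nonneg
  have hc := cst_mul s hs
  have hG : 0 < Gamma (s + 1 / 2) := Gamma_pos_of_pos (by linarith)
  have hG2 : 0 < Gamma (s + 1) := Gamma_pos_of_pos (by linarith)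
  have hcpos : 0 < cst s := by
    have := pi_pos
    unfold cst; positivity
  have hL : 0 < LL s 1 := by
    by_contra h
    push Not at h
    nlinarith
  have hk : kG s (n + 1) ≠ 0 := by
    have : ∀ m, kG s m ≠ 0 := by
      intro m
      induction m with
      | zero => simp [kG]
      | succ m ih =>
        have := s_add_ne hs h0 m
        have : (m : ℝ) + 1 ≠ 0 := by positivity
        rw [kG]; positivity
    exact this _
  have hf : (0 : ℝ) < (n + 1).factorial * ((n + 1 : ℕ) + s) := by
    have : (0 : ℝ) < (n + 1 : ℕ) + s := by push_cast; linarith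
    positivity
  set A := s * (ascPochhammer ℝ (n + 1)).eval (2 * s) with hA
  have hApos : 0 < A := by
    have : 0 < LL s 1 * A := by rw [← hid]; positivity
    exact (mul_pos_iff_of_pos_left hL).1 this
  unfold gamG
  rw [← hA, sq_sqrt (by positivity)]
  set F : ℝ := (n + 1).factorial * ((n + 1 : ℕ) + s)
  have : F / A * kG s (n + 1) ^ 2 * cst s * eG s (n + 1) =
    cst s * (kG s (n + 1) ^ 2 * eG s (n + 1) * F) / A := by ring
  rw [this, hid, ← mul_assoc, hc]
  field_simp

lemma integrand_eq (s : ℝ) (hs : -(1 / 2) < s) (h0 : s ≠ 0) (n : ℕ) (x : ℝ) :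
    GegHat s n x * GegHat s n x * Real.log (1 / (1 - x ^ 2)) * wG s x =
      -(gamG s n ^ 2 * kG s n ^ 2 * cst s) * ((PP s n * PP s n).eval x *
        ((1 - x ^ 2) ^ (s - 1 / 2) * Real.log (1 - x ^ 2))) := by
  rw [one_div, Real.log_inv, GegHat, Geg_eq s hs h0, wG, eval_mul, cst]
  ring

noncomputable def II (s : ℝ) (n : ℕ) : ℝ :=
  -(gamG s n ^ 2 * kG s n ^ 2 * cst s) * ∫ x in Set.Ioo (-1 : ℝ) 1, (PP s n * PP s n).eval x *
        ((1 - x ^ 2) ^ (s - 1 / 2) * Real.log (1 - x ^ 2))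

lemma L3_eq (s : ℝ) (hs : -(1 / 2) < s) (h0 : s ≠ 0) (n : ℕ) :
    L3 s n = ∑ j ∈ Finset.range (n + 1), II s j := by
  unfold L3
  rw [integral_Icc_eq_integral_Ioo]
  have : ∀ x, KG s n x x * Real.log (1 / (1 - x ^ 2)) * wG s x =
      ∑ j ∈ Finset.range (n + 1), -(gamG s j ^ 2 * kG s j ^ 2 * cst s) * ((PP s j * PP s j).eval x *
        ((1 - x ^ 2) ^ (s - 1 / 2) * Real.log (1 - x ^ 2))) := by
    intro x
    rw [KG, Finset.sum_mul, Finset.sum_mul]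
    exact Finset.sum_congr rfl fun j _ => integrand_eq s hs h0 j x
  simp_rw [this]
  rw [integral_finsetSum _ (fun j _ => ((LL_hasDerivAt s hs _).1.const_mul _))]
  exact Finset.sum_congr rfl fun j _ => integral_const_mul _ _

lemma II_eq (s : ℝ) (hs : -(1 / 2) < s) (h0 : s ≠ 0) (n : ℕ) :
    II s (n + 1) = 2 * Real.log 2 - 2 * psi (2 * s + n + 1) + 1 / (s + n + 1)
      + 2 * psi (s + n + 1) := by
  rw [II, main_deriv s hs h0 n, neg_mul, ← mul_assoc, gam_norm s hs h0 n]
  ring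

theorem gegenbauer_L3_asymptotics
    (lam : ℝ) (hlam : -(1 / 2) < lam) (hlam0 : lam ≠ 0) :
    ∃ C > (0 : ℝ), ∃ N : ℕ, ∀ n : ℕ, N ≤ n →
      |L3 lam n - 2 * (n : ℝ) * Real.log 2 + (2 * lam - 1) * Real.log n| ≤ C := by
  set K : ℝ := II lam 0 - psi (lam + 1) - 2 * (lam * psi (lam + 1))
    + 2 * (2 * lam * psi (2 * lam + 1)) with hK
  refine ⟨|K| + 2 * ((|lam + 1 / 2| + 1) * (lam + 2)) + 2 * ((|2 * lam| + 1) * (2 * lam + 2)) + 1,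
    ?_, 1, fun n hn => ?_⟩
  · have h1 : 0 < lam + 2 := by linarith
    have h2 : 0 < 2 * lam + 2 := by linarith
    positivity
  have hA := psi_asym lam (lam + 1 / 2) (by linarith) n hn
  have hB := psi_asym (2 * lam) (2 * lam) (by linarith) n hn
  have hL : L3 lam n = II lam 0 + (n * (2 * Real.log 2)
      - 2 * ((2 * lam + n) * psi (2 * lam + n + 1) - n - 2 * lam * psi (2 * lam + 1))
      + (psi (lam + n + 1) - psi (lam + 1))
      + 2 * ((lam + n) * psi (lam + n + 1) - n - lam * psi (lam + 1))) := by
    rw [L3_eq lam hlam hlam0, Finset.sum_range_succ', ← sum_psi (2 * lam) (by linarith),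
      ← sum_psi lam (by linarith), ← sum_inv lam (by linarith), add_comm]
    congr 1
    rw [Finset.sum_congr rfl fun j _ => II_eq lam hlam hlam0 j]
    simp only [Finset.sum_add_distrib, Finset.sum_sub_distrib, Finset.mul_sum, Finset.sum_const,
      Finset.card_range, nsmul_eq_mul]
  have hE : L3 lam n - 2 * (n : ℝ) * Real.log 2 + (2 * lam - 1) * Real.log n =
      K + 2 * ((lam + 1 / 2 + n) * (psi (lam + n + 1) - Real.log n))
        - 2 * ((2 * lam + n) * (psi (2 * lam + n + 1) - Real.log n)) := by
    rw [hL, hK]; ring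
  rw [hE]
  have hk := abs_le.1 (le_refl |K|)
  rw [abs_le] at hA hB ⊢
  constructor <;> linarith [hA.1, hA.2, hB.1, hB.2, hk.1, hk.2]
end

section
/- Let k ≥ 0 be an integer, s ∈ (0,1), and λ ∈ (-1/2,0) ∪ (0,∞). Then ∫_{-1}^{1} C_k^λ(x)² (1-x²)^{λ-1/2} (1-x)^s dx = [ 2^{s+2λ} · Γ(s+λ+1/2) · Γ(λ+1/2) · Γ(k-s) · Γ(k+2λ)² ] / [ (k!)² · Γ(-s) · Γ(2λ+s+k+1) · Γ(2λ)² ] · Σ_{ℓ=0}^{k} [ (-k)_ℓ · (k+2λ)_ℓ · (s+λ+1/2)_ℓ · (s+1)_ℓ ] / [ ℓ! · (λ+1/2)_ℓ · (2λ+s+k+1)_ℓ · (s-k+1)_ℓ ]. Moreover, for s = 0, ∫_{-1}^{1} C_k^λ(x)² (1-x²)^{λ-1/2} dx = π·2^{1-2λ}·Γ(2λ+k) / ( k!·(k+λ)·Γ(λ)² ). -/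
open Real Finset MeasureTheory

/-- The Pochhammer symbol `(a)_n` for real `a`. -/
noncomputable def poch (a : ℝ) (n : ℕ) : ℝ := (ascPochhammer ℝ n).eval a


lemma poch_zero (a : ℝ) : poch a 0 = 1 := by simp [poch]

lemma poch_succ (a : ℝ) (n : ℕ) : poch a (n + 1) = poch a n * (a + n) := by
  simp only [poch, ascPochhammer_succ_eval]

lemma poch_succ' (a : ℝ) (n : ℕ) : poch a (n + 1) = a * poch (a + 1) n := by
  simp [poch, ascPochhammer_succ_left, Polynomial.eval_comp]

lemma poch_add (a : ℝ) (n m : ℕ) : poch a (n + m) = poch a n * poch (a + n) m := by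
  induction m with
  | zero => simp [poch_zero]
  | succ m ih => rw [← add_assoc, poch_succ, ih, poch_succ]; push_cast; ring

lemma poch_ne_zero (a : ℝ) (n : ℕ) (h : ∀ j : ℕ, a + j ≠ 0) : poch a n ≠ 0 := by
  induction n with
  | zero => simp [poch_zero]
  | succ n ih => rw [poch_succ]; exact mul_ne_zero ih (h n)

lemma poch_neg_of_lt {n k : ℕ} (h : k < n) : poch (-(k : ℝ)) n = 0 :=
  ascPochhammer_eval_neg_coe_nat_of_lt h

lemma Gamma_poch (a : ℝ) (n : ℕ) (h : ∀ j : ℕ, a + j ≠ 0) :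
    Real.Gamma (a + n) = poch a n * Real.Gamma a := by
  induction n with
  | zero => simp [poch_zero]
  | succ n ih =>
    rw [poch_succ]; push_cast
    rw [← add_assoc, Real.Gamma_add_one (h n), ih]; ring

lemma Gamma_ne (a : ℝ) (h : ∀ j : ℕ, a + j ≠ 0) : Real.Gamma a ≠ 0 := by
  apply Real.Gamma_ne_zero
  intro m hm
  exact h m (by rw [hm]; ring)

lemma poch_swap (s : ℝ) (k l : ℕ) :
    poch (-s - l) k * poch (s - k + 1) l = poch (-s) k * poch (s + 1) l := by
  induction l with
  | zero => simp [poch_zero]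
  | succ l ih =>
    have h1 := poch_succ (-s - (l + 1)) k
    have h2 := poch_succ' (-s - (l + 1)) k
    rw [show -s - ((l : ℝ) + 1) + 1 = -s - l by ring] at h2
    rw [poch_succ, poch_succ]
    push_cast
    linear_combination (s + 1 + l) * ih + poch (s - k + 1) l * (h1 - h2)

lemma beta_cast {a b t : ℝ} (ht : t ∈ Set.Ioc (0 : ℝ) 1) :
    (((t ^ (a - 1) * (1 - t) ^ (b - 1) : ℝ)) : ℂ) =
      (t : ℂ) ^ ((a : ℂ) - 1) * (1 - (t : ℂ)) ^ ((b : ℂ) - 1) := by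
  rw [Complex.ofReal_mul, Complex.ofReal_cpow ht.1.le, Complex.ofReal_cpow (by linarith [ht.2])]
  push_cast; rfl

lemma beta_int {a b : ℝ} (ha : 0 < a) (hb : 0 < b) :
    IntervalIntegrable (fun t : ℝ => t ^ (a - 1) * (1 - t) ^ (b - 1)) volume 0 1 := by
  have h := Complex.betaIntegral_convergent (u := a) (v := b) (by simpa) (by simpa)
  rw [intervalIntegrable_iff_integrableOn_Ioc_of_le zero_le_one] at h ⊢
  have h2 : IntegrableOn (fun t : ℝ => (((t ^ (a - 1) * (1 - t) ^ (b - 1) : ℝ)) : ℂ))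
      (Set.Ioc 0 1) volume :=
    h.congr_fun (fun t ht => (beta_cast ht).symm) measurableSet_Ioc
  have h3 : IntegrableOn (fun t : ℝ => ((((t ^ (a - 1) * (1 - t) ^ (b - 1) : ℝ)) : ℂ)).re)
      (Set.Ioc 0 1) volume := Integrable.re h2
  simpa only [Complex.ofReal_re] using h3

lemma beta_val {a b : ℝ} (ha : 0 < a) (hb : 0 < b) :
    ∫ t in (0 : ℝ)..1, t ^ (a - 1) * (1 - t) ^ (b - 1)
      = Real.Gamma a * Real.Gamma b / Real.Gamma (a + b) := by
  have h := ProbabilityTheory.beta_eq_betaIntegralReal a b ha hb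
  rw [ProbabilityTheory.beta] at h
  rw [h, Complex.betaIntegral]
  have : ∫ x : ℝ in (0 : ℝ)..1, (x : ℂ) ^ ((a : ℂ) - 1) * (1 - (x : ℂ)) ^ ((b : ℂ) - 1)
      = ∫ t : ℝ in (0 : ℝ)..1, (((t ^ (a - 1) * (1 - t) ^ (b - 1) : ℝ)) : ℂ) := by
    rw [intervalIntegral.integral_of_le zero_le_one, intervalIntegral.integral_of_le zero_le_one]
    exact setIntegral_congr_fun measurableSet_Ioc (fun t ht => (beta_cast ht).symm)
  rw [this, intervalIntegral.integral_ofReal, Complex.ofReal_re]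

lemma Geg_cont (lam : ℝ) (n : ℕ) : Continuous (Geg lam n) := by
  induction n using Nat.twoStepInduction with
  | zero =>
    have : Geg lam 0 = fun _ => 1 := by funext x; simp [Geg]
    rw [this]; fun_prop
  | one =>
    have : Geg lam 1 = fun x => 2 * lam * x := by funext x; simp [Geg]
    rw [this]; fun_prop
  | more n h0 h1 =>
    have : Geg lam (n + 2) = fun x => (2 * ((n : ℝ) + 1 + lam) * x * Geg lam (n + 1) x
        - ((n : ℝ) + 2 * lam) * Geg lam n x) / ((n : ℝ) + 2) := by funext x; rw [Geg]
    rw [this]; fun_prop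

noncomputable def JJ (lam : ℝ) (n : ℕ) (a : ℝ) : ℝ :=
  ∫ t in (0 : ℝ)..1, Geg lam n (1 - 2 * t) * (t ^ (a - 1) * (1 - t) ^ (lam + 1 / 2 - 1))

lemma JJ_int (lam : ℝ) (hlam : -(1 / 2) < lam) (n : ℕ) {a : ℝ} (ha : 0 < a) :
    IntervalIntegrable
      (fun t : ℝ => Geg lam n (1 - 2 * t) * (t ^ (a - 1) * (1 - t) ^ (lam + 1 / 2 - 1)))
      volume 0 1 := by
  have hG := Geg_cont lam n
  exact (beta_int ha (by linarith)).continuousOn_mul (by fun_prop)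

lemma rpow_shift {a t : ℝ} (l : ℕ) (ht : 0 < t) : t ^ (a + l - 1) = t ^ l * t ^ (a - 1) := by
  rw [show a + l - 1 = (l : ℝ) + (a - 1) by ring, Real.rpow_add ht, Real.rpow_natCast]

lemma JJ_zero (lam : ℝ) (hlam : -(1 / 2) < lam) {a : ℝ} (ha : 0 < a) :
    JJ lam 0 a = Real.Gamma a * Real.Gamma (lam + 1 / 2) / Real.Gamma (a + (lam + 1 / 2)) := by
  rw [← beta_val ha (by linarith)]
  simp [JJ, Geg]

lemma JJ_one (lam : ℝ) (hlam : -(1 / 2) < lam) {a : ℝ} (ha : 0 < a) :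
    JJ lam 1 a = 2 * lam * (JJ lam 0 a - 2 * JJ lam 0 (a + 1)) := by
  have i0 := JJ_int lam hlam 0 ha
  have i1 := JJ_int lam hlam 0 (show 0 < a + 1 by linarith)
  unfold JJ
  rw [← intervalIntegral.integral_const_mul, ← intervalIntegral.integral_sub i0 (i1.const_mul 2),
    ← intervalIntegral.integral_const_mul]
  rw [intervalIntegral.integral_of_le zero_le_one, intervalIntegral.integral_of_le zero_le_one]
  refine setIntegral_congr_fun measurableSet_Ioc (fun t ht => ?_)
  have := rpow_shift (a := a) 1 ht.1
  push_cast at this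
  simp only [Geg, this]
  ring

lemma JJ_rec (lam : ℝ) (hlam : -(1 / 2) < lam) (n : ℕ) {a : ℝ} (ha : 0 < a) :
    JJ lam (n + 2) a = (2 * ((n : ℝ) + 1 + lam) * (JJ lam (n + 1) a - 2 * JJ lam (n + 1) (a + 1))
        - ((n : ℝ) + 2 * lam) * JJ lam n a) / ((n : ℝ) + 2) := by
  have i0 := JJ_int lam hlam n ha
  have i1 := JJ_int lam hlam (n + 1) ha
  have i2 := JJ_int lam hlam (n + 1) (show 0 < a + 1 by linarith)
  unfold JJ
  rw [← intervalIntegral.integral_const_mul, ← intervalIntegral.integral_sub i1 (i2.const_mul 2),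
    ← intervalIntegral.integral_const_mul, ← intervalIntegral.integral_const_mul,
    ← intervalIntegral.integral_sub ((i1.sub (i2.const_mul 2)).const_mul _) (i0.const_mul _),
    ← intervalIntegral.integral_div]
  rw [intervalIntegral.integral_of_le zero_le_one, intervalIntegral.integral_of_le zero_le_one]
  refine setIntegral_congr_fun measurableSet_Ioc (fun t ht => ?_)
  have := rpow_shift (a := a) 1 ht.1
  push_cast at this
  simp only [this]
  rw [Geg]
  ring

lemma JJ_val (lam : ℝ) (hlam : -(1 / 2) < lam) (n : ℕ) : ∀ {a : ℝ}, 0 < a →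
    JJ lam n a = poch (2 * lam) n / n.factorial *
      (Real.Gamma a * Real.Gamma (lam + 1 / 2) * poch (lam + 1 / 2 - a) n
        / Real.Gamma (a + (lam + 1 / 2) + n)) := by
  induction n using Nat.twoStepInduction with
  | zero => intro a ha; rw [JJ_zero lam hlam ha]; simp [poch_zero]
  | one =>
    intro a ha
    have hp : 0 < a + (lam + 1 / 2) := by linarith
    have hg := (Real.Gamma_pos_of_pos hp).ne'
    rw [JJ_one lam hlam ha, JJ_zero lam hlam ha, JJ_zero lam hlam (by linarith),
      show a + 1 + (lam + 1 / 2) = a + (lam + 1 / 2) + 1 by ring, Real.Gamma_add_one ha.ne',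
      Nat.cast_one, Real.Gamma_add_one hp.ne', poch_succ, poch_succ, poch_zero, poch_zero]
    have hu' := hp.ne'
    generalize Real.Gamma (a + (lam + 1 / 2)) = G at *
    generalize Real.Gamma (lam + 1 / 2) = Gb at *
    generalize Real.Gamma a = Ga at *
    obtain ⟨u, hu⟩ : ∃ u, u = a + (lam + 1 / 2) := ⟨_, rfl⟩
    have hau : a = u - lam - 1 / 2 := by rw [hu]; ring
    rw [← hu] at hu' ⊢
    clear hu hp ha
    subst hau
    simp only [Nat.factorial_one, Nat.cast_one, Nat.cast_zero]
    field_simp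
    ring
  | more n h0 h1 =>
    intro a ha
    have hp : 0 < a + (lam + 1 / 2) := by linarith
    have hn : (0 : ℝ) ≤ n := by positivity
    have hp0 : 0 < a + (lam + 1 / 2) + n := by linarith
    have hp1 : 0 < a + (lam + 1 / 2) + n + 1 := by linarith
    have hg := (Real.Gamma_pos_of_pos hp0).ne'
    have hf : (n.factorial : ℝ) ≠ 0 := by positivity
    rw [JJ_rec lam hlam n ha, h0 ha, h1 ha, h1 (a := a + 1) (by linarith)]
    have e1 : Real.Gamma (a + (lam + 1 / 2) + (n + 1 : ℕ)) =
        (a + (lam + 1 / 2) + n) * Real.Gamma (a + (lam + 1 / 2) + n) := by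
      rw [← Real.Gamma_add_one hp0.ne']; congr 1; push_cast; ring
    have e2 : Real.Gamma (a + (lam + 1 / 2) + (n + 2 : ℕ)) =
        (a + (lam + 1 / 2) + n + 1) * ((a + (lam + 1 / 2) + n) *
          Real.Gamma (a + (lam + 1 / 2) + n)) := by
      rw [← Real.Gamma_add_one hp0.ne', ← Real.Gamma_add_one hp1.ne']
      congr 1; push_cast; ring
    have e3 : Real.Gamma (a + 1 + (lam + 1 / 2) + (n + 1 : ℕ)) =
        (a + (lam + 1 / 2) + n + 1) * ((a + (lam + 1 / 2) + n) *
          Real.Gamma (a + (lam + 1 / 2) + n)) := by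
      rw [← e2]; congr 1; push_cast; ring
    have e4 : poch (lam + 1 / 2 - (a + 1)) (n + 1)
        = (lam + 1 / 2 - a - 1) * poch (lam + 1 / 2 - a) n := by
      rw [poch_succ', show lam + 1 / 2 - (a + 1) + 1 = lam + 1 / 2 - a by ring]; ring
    rw [e1, e2, e3, e4, Real.Gamma_add_one ha.ne', show n + 2 = (n + 1) + 1 from rfl,
      poch_succ _ (n + 1), poch_succ _ n, poch_succ _ (n + 1), poch_succ _ n,
      Nat.factorial_succ (n + 1), Nat.factorial_succ n]
    push_cast
    have q0 := hp0.ne'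
    have q1 := hp1.ne'
    have q2 : (n : ℝ) + 2 ≠ 0 := by positivity
    have q3 : (n : ℝ) + 1 ≠ 0 := by positivity
    have q4 : (n : ℝ) + 1 + 1 ≠ 0 := by positivity
    generalize Real.Gamma (a + (lam + 1 / 2) + n) = G at *
    generalize poch (lam + 1 / 2 - a) n = P at *
    generalize poch (2 * lam) n = Q at *
    generalize Real.Gamma a = Ga at *
    generalize Real.Gamma (lam + 1 / 2) = Gb at *
    generalize (n.factorial : ℝ) = N at *
    rw [show (n : ℝ) + 1 + 1 = n + 2 by ring]
    obtain ⟨u, hu⟩ : ∃ u, u = a + (lam + 1 / 2) + n := ⟨_, rfl⟩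
    have hau : a = u - n - lam - 1 / 2 := by rw [hu]; ring
    rw [← hu] at q0 q1 ⊢
    clear e1 e2 e3 e4 h0 h1 hu hp hp0 hp1 ha
    subst hau
    field_simp
    ring

noncomputable def gc (lam : ℝ) (n l : ℕ) : ℝ :=
  poch (-(n : ℝ)) l * poch (2 * lam) (n + l) /
    (n.factorial * (l.factorial * poch (lam + 1 / 2) l))

lemma gc_zero_rec (lam : ℝ) (n : ℕ) :
    ((n : ℝ) + 2) * gc lam (n + 2) 0 = 2 * ((n : ℝ) + 1 + lam) * gc lam (n + 1) 0
      - ((n : ℝ) + 2 * lam) * gc lam n 0 := by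
  have hf : (n.factorial : ℝ) ≠ 0 := by positivity
  have q2 : (n : ℝ) + 2 ≠ 0 := by positivity
  have q3 : (n : ℝ) + 1 ≠ 0 := by positivity
  simp only [gc, poch_zero, add_zero, show n + 2 = (n + 1) + 1 from rfl, poch_succ,
    Nat.factorial_succ]
  push_cast
  rw [show (n : ℝ) + 1 + 1 = n + 2 by ring]
  field_simp
  ring

lemma gc_succ_rec (lam : ℝ) (hlam : -(1 / 2) < lam) (n l : ℕ) :
    ((n : ℝ) + 2) * gc lam (n + 2) (l + 1) =
      2 * ((n : ℝ) + 1 + lam) * (gc lam (n + 1) (l + 1) - 2 * gc lam (n + 1) l)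
      - ((n : ℝ) + 2 * lam) * gc lam n (l + 1) := by
  have hf : (n.factorial : ℝ) ≠ 0 := by positivity
  have q2 : (n : ℝ) + 2 ≠ 0 := by positivity
  have q3 : (n : ℝ) + 1 ≠ 0 := by positivity
  have hb : ∀ j : ℕ, lam + 1 / 2 + (j : ℝ) ≠ 0 := fun j => by
    have : (0 : ℝ) ≤ j := by positivity
    linarith
  cases l with
  | zero =>
    have := hb 0
    simp only [gc, poch_zero, add_zero, zero_add, show n + 2 = (n + 1) + 1 from rfl, poch_succ,
      Nat.factorial_succ, Nat.factorial_zero, poch_succ (-(n : ℝ)) 0]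
    push_cast at *
    rw [add_zero] at this
    rw [show (n : ℝ) + 1 + 1 = n + 2 by ring]
    simp only [add_zero]
    generalize poch (2 * lam) n = B at *
    obtain ⟨u, hu⟩ : ∃ u, u = lam + 1 / 2 := ⟨_, rfl⟩
    have hau : lam = u - 1 / 2 := by rw [hu]; ring
    rw [← hu] at this ⊢
    clear hu hb hlam
    subst hau
    field_simp
    ring
  | succ m =>
    have h0 := hb m
    have h1 := hb (m + 1)
    have h2 := poch_ne_zero _ m hb
    have r1 : (m : ℝ) + 1 ≠ 0 := by positivity
    have r2 : (m : ℝ) + 2 ≠ 0 := by positivity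
    have hm : (m.factorial : ℝ) ≠ 0 := by positivity
    have p1 : poch (-((n + 1 : ℕ) : ℝ)) (m + 1) = -((n : ℝ) + 1) * poch (-(n : ℝ)) m := by
      rw [poch_succ']; push_cast; congr 2; ring
    have p2 : poch (-((n + 1 : ℕ) : ℝ)) (m + 1 + 1) =
        -((n : ℝ) + 1) * (poch (-(n : ℝ)) m * (-(n : ℝ) + m)) := by
      rw [poch_succ, p1]; push_cast; ring
    have p3 : poch (-((n + 2 : ℕ) : ℝ)) (m + 1 + 1) =
        ((n : ℝ) + 2) * ((n : ℝ) + 1) * poch (-(n : ℝ)) m := by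
      rw [poch_succ', show -((n + 2 : ℕ) : ℝ) + 1 = -((n + 1 : ℕ) : ℝ) by push_cast; ring, p1]
      push_cast; ring
    have p4 : poch (-(n : ℝ)) (m + 1 + 1) =
        poch (-(n : ℝ)) m * (-(n : ℝ) + m) * (-(n : ℝ) + m + 1) := by
      rw [poch_succ, poch_succ]; push_cast; ring
    simp only [gc, p1, p2, p3, p4]
    rw [show n + 2 + (m + 1 + 1) = n + m + 2 + 1 + 1 by ring,
      show n + 1 + (m + 1 + 1) = n + m + 2 + 1 by ring,
      show n + 1 + (m + 1) = n + m + 2 by ring, show n + (m + 1 + 1) = n + m + 2 by ring,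
      poch_succ _ (n + m + 2 + 1), poch_succ _ (n + m + 2), poch_succ _ (m + 1), poch_succ _ m,
      show n + 2 = n + 1 + 1 from rfl, Nat.factorial_succ, Nat.factorial_succ,
      Nat.factorial_succ (m + 1), Nat.factorial_succ m]
    push_cast at *
    rw [show (n : ℝ) + 1 + 1 = n + 2 by ring, show (m : ℝ) + 1 + 1 = m + 2 by ring]
    generalize poch (lam + 1 / 2) m = P at *
    generalize poch (-(n : ℝ)) m = A at *
    generalize poch (2 * lam) (n + m + 2) = B at *
    generalize (n.factorial : ℝ) = N at *
    generalize (m.factorial : ℝ) = M at *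
    obtain ⟨u, hu⟩ : ∃ u, u = lam + 1 / 2 + m := ⟨_, rfl⟩
    have hau : lam = u - m - 1 / 2 := by rw [hu]; ring
    have hs1 : lam + 1 / 2 + ((m : ℝ) + 1) = u + 1 := by rw [hu]; ring
    rw [hs1] at h1 ⊢
    rw [← hu] at h0 ⊢
    clear hu hb p1 p2 p3 p4 hlam
    subst hau
    field_simp
    ring

lemma gc_of_lt (lam : ℝ) {n l : ℕ} (h : n < l) : gc lam n l = 0 := by
  simp [gc, poch_neg_of_lt h]

lemma Geg_exp (lam : ℝ) (hlam : -(1 / 2) < lam) (n : ℕ) : ∀ N : ℕ, n ≤ N → ∀ t : ℝ,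
    Geg lam n (1 - 2 * t) = ∑ l ∈ range (N + 1), gc lam n l * t ^ l := by
  induction n using Nat.twoStepInduction with
  | zero =>
    intro N _ t
    rw [Finset.sum_range_succ', Finset.sum_eq_zero (fun l _ => by simp [gc_of_lt])]
    simp [gc, poch_zero, Geg]
  | one =>
    intro N hN t
    obtain ⟨M, rfl⟩ : ∃ M, N = M + 1 := ⟨N - 1, by omega⟩
    rw [Finset.sum_range_succ', Finset.sum_range_succ',
      Finset.sum_eq_zero (fun l _ => by rw [gc_of_lt lam (by omega), zero_mul])]
    have hb : lam + 1 / 2 ≠ 0 := by linarith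
    have h4 : poch (2 * lam) 2 = 4 * lam * (lam + 1 / 2) := by
      have := poch_succ (2 * lam) 1
      rw [poch_succ (2 * lam) 0, poch_zero] at this
      rw [this]; push_cast; ring
    simp only [gc, poch_zero, Geg, zero_add, Nat.factorial_zero, Nat.factorial_one,
      show 1 + 1 = 2 from rfl, add_zero]
    have h1 : poch (2 * lam) 1 = 2 * lam := by
      have := poch_succ (2 * lam) 0
      simpa [poch_zero] using this
    have h2 : poch (-((1 : ℕ) : ℝ)) 1 = -1 := by
      have := poch_succ (-((1 : ℕ) : ℝ)) 0
      simpa [poch_zero] using this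
    have h3 : poch (lam + 1 / 2) 1 = lam + 1 / 2 := by
      have := poch_succ (lam + 1 / 2) 0
      simpa [poch_zero] using this
    simp only [h1, h2, h3, h4]
    push_cast
    generalize lam + 1 / 2 = u at *
    field_simp
    ring
  | more n h0 h1 =>
    intro N hN t
    obtain ⟨M, rfl⟩ : ∃ M, N = M + 1 := ⟨N - 1, by omega⟩
    have q2 : (n : ℝ) + 2 ≠ 0 := by positivity
    rw [Geg, div_eq_iff q2]
    have e1 := h1 (M + 1) (by omega) t
    have e2 := h1 M (by omega) t
    have e0 := h0 (M + 1) (by omega) t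
    have key : (∑ l ∈ range (M + 1 + 1), gc lam (n + 2) l * t ^ l) * ((n : ℝ) + 2)
        = 2 * ((n : ℝ) + 1 + lam) * ((∑ l ∈ range (M + 1 + 1), gc lam (n + 1) l * t ^ l)
          - 2 * (t * ∑ l ∈ range (M + 1), gc lam (n + 1) l * t ^ l))
          - ((n : ℝ) + 2 * lam) * ∑ l ∈ range (M + 1 + 1), gc lam n l * t ^ l := by
      rw [Finset.sum_range_succ', Finset.sum_range_succ' _ (M + 1),
        Finset.sum_range_succ' _ (M + 1)]
      have hs : (∑ l ∈ range (M + 1), gc lam (n + 2) (l + 1) * t ^ (l + 1)) * ((n : ℝ) + 2)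
        = 2 * ((n : ℝ) + 1 + lam) * ((∑ l ∈ range (M + 1), gc lam (n + 1) (l + 1) * t ^ (l + 1))
          - 2 * (t * ∑ l ∈ range (M + 1), gc lam (n + 1) l * t ^ l))
          - ((n : ℝ) + 2 * lam) * ∑ l ∈ range (M + 1), gc lam n (l + 1) * t ^ (l + 1) := by
        simp only [Finset.mul_sum, Finset.sum_mul, ← Finset.sum_sub_distrib]
        refine Finset.sum_congr rfl fun l _ => ?_
        linear_combination t ^ (l + 1) * gc_succ_rec lam hlam n l
      linear_combination hs + gc_zero_rec lam n
    rw [key, ← e1, ← e2, ← e0]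
    ring

lemma sq_int (lam : ℝ) (hlam : -(1 / 2) < lam) (k : ℕ) {a : ℝ} (ha : 0 < a) :
    ∫ t in (0 : ℝ)..1, Geg lam k (1 - 2 * t) ^ 2 * (t ^ (a - 1) * (1 - t) ^ (lam + 1 / 2 - 1))
      = ∑ l ∈ range (k + 1), gc lam k l * JJ lam k (a + l) := by
  have hi : ∀ l : ℕ, 0 < a + l := fun l => by positivity
  unfold JJ
  simp_rw [← intervalIntegral.integral_const_mul]
  rw [← intervalIntegral.integral_finsetSum
    (fun l _ => (JJ_int lam hlam k (hi l)).const_mul _)]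
  rw [intervalIntegral.integral_of_le zero_le_one, intervalIntegral.integral_of_le zero_le_one]
  refine setIntegral_congr_fun measurableSet_Ioc (fun t ht => ?_)
  simp only [rpow_shift _ ht.1]
  rw [sq]
  conv_lhs => rw [mul_assoc]
  conv_lhs => enter [1]; rw [Geg_exp lam hlam k k le_rfl t]
  rw [Finset.sum_mul]
  exact Finset.sum_congr rfl fun l _ => by ring

lemma main_int (lam : ℝ) (hlam : -(1 / 2) < lam) (k : ℕ) (s : ℝ) (hs : 0 ≤ s) :
    (∫ x in Set.Icc (-1 : ℝ) 1,
          Geg lam k x ^ 2 * (1 - x ^ 2) ^ (lam - 1 / 2) * (1 - x) ^ s) =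
      (2 : ℝ) ^ (s + 2 * lam) * ∑ l ∈ range (k + 1), gc lam k l * JJ lam k (s + lam + 1 / 2 + l) := by
  rw [← sq_int lam hlam k (by linarith), integral_Icc_eq_integral_Ioc,
    ← intervalIntegral.integral_of_le (by norm_num)]
  have h := intervalIntegral.integral_comp_sub_mul (a := 0) (b := 1) (c := (2 : ℝ))
    (fun x => Geg lam k x ^ 2 * (1 - x ^ 2) ^ (lam - 1 / 2) * (1 - x) ^ s) two_ne_zero 1
  norm_num at h
  have h' := congrArg (fun z => 2 * z) h
  rw [show ∀ z : ℝ, 2 * (1 / 2 * z) = z by intro z; ring] at h'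
  norm_num
  rw [← h', ← intervalIntegral.integral_const_mul, ← intervalIntegral.integral_const_mul]
  rw [intervalIntegral.integral_of_le zero_le_one, intervalIntegral.integral_of_le zero_le_one]
  rw [integral_Ioc_eq_integral_Ioo, integral_Ioc_eq_integral_Ioo]
  refine setIntegral_congr_fun measurableSet_Ioo (fun t ht => ?_)
  have ht0 : 0 < t := ht.1
  have ht1 : 0 < 1 - t := by linarith [ht.2]
  rw [show 1 - (1 - 2 * t) ^ 2 = 2 ^ (2 : ℝ) * (t * (1 - t)) by norm_num; ring,
    Real.mul_rpow (by positivity) (by positivity),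
    Real.mul_rpow ht0.le ht1.le, Real.mul_rpow (by norm_num) ht0.le, ← Real.rpow_mul (by norm_num),
    show s + lam + 1 / 2 - 1 = (lam - 1 / 2) + s by ring, Real.rpow_add ht0,
    show lam + 1 / 2 - 1 = lam - 1 / 2 by ring,
    show s + 2 * lam = 1 + 2 * (lam - 1 / 2) + s by ring, Real.rpow_add (by norm_num),
    Real.rpow_add (by norm_num), Real.rpow_one]
  ring

set_option maxHeartbeats 2000000 in
theorem gegenbauer_weighted_power_integral
    (lam : ℝ) (hlam : -(1 / 2) < lam) (hlam0 : lam ≠ 0) (k : ℕ) :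
    (∀ s : ℝ, s ∈ Set.Ioo (0 : ℝ) 1 →
      (∫ x in Set.Icc (-1 : ℝ) 1,
          Geg lam k x ^ 2 * (1 - x ^ 2) ^ (lam - 1 / 2) * (1 - x) ^ s) =
        (2 : ℝ) ^ (s + 2 * lam) * Real.Gamma (s + lam + 1 / 2) * Real.Gamma (lam + 1 / 2)
            * Real.Gamma ((k : ℝ) - s) * Real.Gamma ((k : ℝ) + 2 * lam) ^ 2 /
          (((k.factorial : ℝ)) ^ 2 * Real.Gamma (-s) * Real.Gamma (2 * lam + s + (k : ℝ) + 1)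
            * Real.Gamma (2 * lam) ^ 2) *
        ∑ l ∈ Finset.range (k + 1),
          poch (-(k : ℝ)) l * poch ((k : ℝ) + 2 * lam) l * poch (s + lam + 1 / 2) l
              * poch (s + 1) l /
            ((l.factorial : ℝ) * poch (lam + 1 / 2) l * poch (2 * lam + s + (k : ℝ) + 1) l
              * poch (s - (k : ℝ) + 1) l)) ∧
    (∫ x in Set.Icc (-1 : ℝ) 1, Geg lam k x ^ 2 * (1 - x ^ 2) ^ (lam - 1 / 2)) =
      Real.pi * (2 : ℝ) ^ (1 - 2 * lam) * Real.Gamma (2 * lam + (k : ℝ)) /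
        ((k.factorial : ℝ) * ((k : ℝ) + lam) * Real.Gamma lam ^ 2) := by

  have hb : ∀ j : ℕ, lam + 1 / 2 + (j : ℝ) ≠ 0 := fun j => by
    have : (0 : ℝ) ≤ j := by positivity
    linarith
  have h2l : ∀ j : ℕ, 2 * lam + (j : ℝ) ≠ 0 := fun j => by
    cases j with
    | zero => simpa using hlam0
    | succ j =>
      have : (0 : ℝ) ≤ j := by positivity
      push_cast; linarith
  have hkf : (k.factorial : ℝ) ≠ 0 := by positivity
  have hG2 := Gamma_ne _ h2l
  have hk2 : Real.Gamma (2 * lam + k) = poch (2 * lam) k * Real.Gamma (2 * lam) :=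
    Gamma_poch _ k h2l
  constructor
  · rintro s ⟨hs0, hs1⟩
    rw [main_int lam hlam k s hs0.le, Finset.mul_sum, Finset.mul_sum]
    refine Finset.sum_congr rfl fun l _ => ?_
    have hl : (0 : ℝ) ≤ l := by positivity
    have hk : (0 : ℝ) ≤ k := by positivity
    have hns : ∀ j : ℤ, s ≠ j := fun j hj => by
      rw [hj] at hs0 hs1
      have h1 : (0 : ℤ) < j := by exact_mod_cast hs0
      have h2 : j < (1 : ℤ) := by exact_mod_cast hs1
      omega
    have hms : ∀ j : ℕ, -s + (j : ℝ) ≠ 0 := fun j hj => hns j (by push_cast; linarith)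
    have hsk : ∀ j : ℕ, s - k + 1 + (j : ℝ) ≠ 0 := fun j hj =>
      hns (k - 1 - j) (by push_cast; linarith)
    have hu : ∀ j : ℕ, s + lam + 1 / 2 + (j : ℝ) ≠ 0 := fun j => by
      have : (0 : ℝ) ≤ j := by positivity
      linarith
    have hv : ∀ j : ℕ, 2 * lam + s + k + 1 + (j : ℝ) ≠ 0 := fun j => by
      have : (0 : ℝ) ≤ j := by positivity
      linarith
    rw [JJ_val lam hlam k (by linarith), gc, poch_add, Gamma_poch _ l hu,
      show s + lam + 1 / 2 + l + (lam + 1 / 2) + k = 2 * lam + s + k + 1 + l by ring,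
      Gamma_poch _ l hv, show lam + 1 / 2 - (s + lam + 1 / 2 + l) = -s - l by ring,
      show (k : ℝ) - s = -s + k by ring, Gamma_poch _ k hms, add_comm (k : ℝ) (2 * lam), hk2]
    have a1 := poch_ne_zero _ l hsk
    have a2 := poch_ne_zero _ l hv
    have a3 := poch_ne_zero _ l hb
    have a4 := Gamma_ne _ hms
    have a5 := Gamma_ne _ hv
    have a6 : (l.factorial : ℝ) ≠ 0 := by positivity
    have hsw : poch (-s - l) k = poch (-s) k * poch (s + 1) l / poch (s - k + 1) l := by
      rw [eq_div_iff a1]; exact poch_swap s k l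
    rw [hsw]
    generalize poch (s - k + 1) l = A1 at *
    generalize poch (2 * lam + s + k + 1) l = A2 at *
    generalize poch (lam + 1 / 2) l = A3 at *
    generalize Real.Gamma (-s) = A4 at *
    generalize Real.Gamma (2 * lam + s + k + 1) = A5 at *
    generalize Real.Gamma (2 * lam) = A6 at *
    generalize Real.Gamma (lam + 1 / 2) = A7 at *
    generalize Real.Gamma (s + lam + 1 / 2) = A8 at *
    generalize poch (s + lam + 1 / 2) l = A9 at *
    generalize (2 : ℝ) ^ (s + 2 * lam) = A10 at *
    field_simp
  · have h := main_int lam hlam k 0 le_rfl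
    simp only [Real.rpow_zero, mul_one, zero_add] at h
    rw [h, Finset.sum_range_succ, Finset.sum_eq_zero, zero_add]
    · have hk : (0 : ℝ) ≤ k := by positivity
      have hlk : (k : ℝ) + lam ≠ 0 := by
        have := h2l (2 * k)
        push_cast at this
        intro h0
        exact this (by linarith)
      have hGl : Real.Gamma lam ≠ 0 := Gamma_ne _ fun j => by
        have := h2l (2 * j)
        push_cast at this
        intro h0
        exact this (by linarith)
      have hdup := Real.Gamma_mul_Gamma_add_half lam
      have hpk : poch (-(k : ℝ)) k ^ 2 = (k.factorial : ℝ) ^ 2 := by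
        have hsw := poch_swap 0 k k
        have h1 : ∀ m : ℕ, poch (-(m : ℝ)) m = (-1) ^ m * m.factorial := fun m => by
          induction m with
          | zero => simp [poch_zero]
          | succ m ih =>
            rw [poch_succ', show -((m + 1 : ℕ) : ℝ) + 1 = -(m : ℝ) by push_cast; ring, ih,
              Nat.factorial_succ]
            push_cast; ring
        rw [h1, mul_pow, ← pow_mul, mul_comm k 2, pow_mul]
        simp
      have hGk : Real.Gamma (lam + 1 / 2 + k) = poch (lam + 1 / 2) k * Real.Gamma (lam + 1 / 2) :=
        Gamma_poch _ k hb
      have hG2k : Real.Gamma (lam + 1 / 2 + k + (lam + 1 / 2) + k) =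
          2 * (k + lam) * (poch (2 * lam) (k + k) * Real.Gamma (2 * lam)) := by
        rw [← Gamma_poch _ (k + k) h2l, show lam + 1 / 2 + k + (lam + 1 / 2) + k =
          2 * lam + ((k + k : ℕ) : ℝ) + 1 by push_cast; ring, Real.Gamma_add_one (h2l _)]
        push_cast; ring
      rw [JJ_val lam hlam k (by linarith), gc, hGk, hG2k, hk2,
        show lam + 1 / 2 - (lam + 1 / 2 + k) = -(k : ℝ) by ring]
      have a1 := poch_ne_zero _ k hb
      have a2 := poch_ne_zero _ (k + k) h2l
      have hhalf : Real.Gamma (lam + 1 / 2) =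
          Real.Gamma (2 * lam) * 2 ^ (1 - 2 * lam) * √Real.pi / Real.Gamma lam := by
        rw [eq_div_iff hGl, ← hdup]; ring
      have hpi : √Real.pi ^ 2 = Real.pi := Real.sq_sqrt Real.pi_pos.le
      have htwo : (2 : ℝ) ^ (2 * lam) * 2 ^ (1 - 2 * lam) = 2 := by
        rw [← Real.rpow_add (by norm_num)]; norm_num
      rw [← hpi, hhalf]
      generalize poch (lam + 1 / 2) k = A1 at *
      generalize poch (2 * lam) (k + k) = A2 at *
      generalize Real.Gamma (2 * lam) = A3 at *
      generalize Real.Gamma lam = A4 at *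
      generalize (2 : ℝ) ^ (2 * lam) = A5 at *
      generalize (2 : ℝ) ^ (1 - 2 * lam) = A6 at *
      generalize √Real.pi = A7 at *
      generalize poch (-(k : ℝ)) k = A8 at *
      generalize poch (2 * lam) k = A9 at *
      generalize (k.factorial : ℝ) = N at *
      generalize (k : ℝ) + lam = u at *
      clear h h2l hb hk2 hdup hGk hG2k hhalf
      field_simp
      rw [hpk]
      linear_combination (N ^ 2 * A9 * A6 * A7 ^ 2) * htwo
    · intro l hl
      rw [JJ_val lam hlam k (by have : (0 : ℝ) ≤ l := by positivity
                                linarith),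
        show lam + 1 / 2 - (lam + 1 / 2 + l) = -(l : ℝ) by ring,
        poch_neg_of_lt (Finset.mem_range.mp hl)]
      simp
end
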